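/- Bernstein–von Mises theorem (Theorem 6): assume s* = o(√n / log n) and E_{β*}[π^n(S*)] → 1. Then E_{β*}[H²(Π^n, N_{s*}(β̂_{S*}, (σ₀²/(α+γ))(X_{S*}ᵀX_{S*})⁻¹) ⊗ δ_{0,S*^c})] → 0 as n → ∞, uniformly over all true coefficient vectors β* satisfying the assumptions; consequently, since d_TV ≤ H², also E_{β*}[d_TV(Π^n, N_{s*}(β̂_{S*}, (σ₀²/(α+γ))(X_{S*}ᵀX_{S*})⁻¹) ⊗ δ_{0,S*^c})] → 0, where δ_{0,S*^c} is the point mass at 0 for the coordinates in S*^c. -/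

import Mathlib

open MeasureTheory ProbabilityTheory Real Filter Matrix
open scoped ENNReal NNReal BigOperators Classical

noncomputable section

namespace EmpiricalBayes

/-- Submatrix of columns of `X` indexed by `S`. -/
def XS {n p : ℕ} (X : Matrix (Fin n) (Fin p) ℝ) (S : Finset (Fin p)) :
    Matrix (Fin n) {j // j ∈ S} ℝ := Matrix.of fun i j => X i j.1

/-- The Gram matrix `X_Sᵀ X_S`. -/
def gram {n p : ℕ} (X : Matrix (Fin n) (Fin p) ℝ) (S : Finset (Fin p)) :
    Matrix {j // j ∈ S} {j // j ∈ S} ℝ := (XS X S)ᵀ * XS X S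

/-- Least squares estimator `β̂_S = (X_SᵀX_S)⁻¹X_Sᵀ y`. -/
def betaHat {n p : ℕ} (X : Matrix (Fin n) (Fin p) ℝ) (S : Finset (Fin p))
    (y : Fin n → ℝ) : {j // j ∈ S} → ℝ := ((gram X S)⁻¹ * (XS X S)ᵀ).mulVec y

/-- Fitted values `ŷ_S = X_S β̂_S`. -/
def yHat {n p : ℕ} (X : Matrix (Fin n) (Fin p) ℝ) (S : Finset (Fin p))
    (y : Fin n → ℝ) : Fin n → ℝ := (XS X S).mulVec (betaHat X S y)

/-- Residual sum of squares `‖y - ŷ_S‖²`. -/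
def rss {n p : ℕ} (X : Matrix (Fin n) (Fin p) ℝ) (S : Finset (Fin p))
    (y : Fin n → ℝ) : ℝ := ∑ i, (y i - yHat X S y i) ^ 2

/-- Quadratic form `(β_S - β̂_S)ᵀ X_SᵀX_S (β_S - β̂_S)`. -/
def quadForm {n p : ℕ} (X : Matrix (Fin n) (Fin p) ℝ) (S : Finset (Fin p))
    (y : Fin n → ℝ) (b : {j // j ∈ S} → ℝ) : ℝ :=
  (b - betaHat X S y) ⬝ᵥ ((gram X S).mulVec (b - betaHat X S y))

/-- Prior weight `π(S) = binom(p,|S|)⁻¹ (c p^a)^{-|S|}` for `|S| ≤ R`, `0` otherwise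
(the normalizing constant of `f_n` is irrelevant, as it cancels in the posterior). -/
def priorWt (p R : ℕ) (a c : ℝ) (S : Finset (Fin p)) : ℝ :=
  if S.card ≤ R then ((p.choose S.card : ℝ))⁻¹ * (c * (p : ℝ) ^ a) ^ (-(S.card : ℝ)) else 0

/-- Exponent `nα/2 + s/2 + a₀` of the multivariate t kernel. -/
def tExp (n : ℕ) (α a₀ : ℝ) (s : ℕ) : ℝ := n * α / 2 + s / 2 + a₀

/-- The (unnormalized) density `D_S^n(β_S)` of the empirical Bayes posterior on model `S`. -/
def Ddens {n p : ℕ} (R : ℕ) (X : Matrix (Fin n) (Fin p) ℝ) (a₀ b₀ a c γ α : ℝ)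
    (y : Fin n → ℝ) (S : Finset (Fin p)) (b : {j // j ∈ S} → ℝ) : ℝ :=
  priorWt p R a c S * (2 * π) ^ (-(S.card : ℝ) / 2) * Real.Gamma (tExp n α a₀ S.card) *
    Real.sqrt ((γ • gram X S).det) *
    (b₀ + (α + γ) / 2 * quadForm X S y b + α / 2 * rss X S y) ^ (-(tExp n α a₀ S.card))

/-- Augment `β_S` with zeros outside `S`. -/
def augment {p : ℕ} (S : Finset (Fin p)) (b : {j // j ∈ S} → ℝ) : Fin p → ℝ :=
  fun j => if h : j ∈ S then b ⟨j, h⟩ else 0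

/-- The contribution `∫ D_S^n(dβ_S) δ_0(dβ_{S^c})` of model `S` to the (unnormalized)
empirical Bayes posterior. -/
def modelMeasure {n p : ℕ} (R : ℕ) (X : Matrix (Fin n) (Fin p) ℝ) (a₀ b₀ a c γ α : ℝ)
    (y : Fin n → ℝ) (S : Finset (Fin p)) : Measure (Fin p → ℝ) :=
  Measure.map (augment S)
    ((volume : Measure ({j // j ∈ S} → ℝ)).withDensity
      fun b => ENNReal.ofReal (Ddens R X a₀ b₀ a c γ α y S b))

/-- The unnormalized empirical Bayes posterior `Σ_S ∫ D_S^n(dβ_S) δ_0(dβ_{S^c})`. -/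
def postUnnorm {n p : ℕ} (R : ℕ) (X : Matrix (Fin n) (Fin p) ℝ) (a₀ b₀ a c γ α : ℝ)
    (y : Fin n → ℝ) : Measure (Fin p → ℝ) :=
  ∑ S : Finset (Fin p), modelMeasure R X a₀ b₀ a c γ α y S

/-- The empirical Bayes posterior `Π^n` on `ℝ^p`. -/
def post {n p : ℕ} (R : ℕ) (X : Matrix (Fin n) (Fin p) ℝ) (a₀ b₀ a c γ α : ℝ)
    (y : Fin n → ℝ) : Measure (Fin p → ℝ) :=
  (postUnnorm R X a₀ b₀ a c γ α y Set.univ)⁻¹ • postUnnorm R X a₀ b₀ a c γ α y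

/-- The Gaussian measure `N_n(m, v I_n)` on `ℝⁿ`. -/
def gaussVec (n : ℕ) (m : Fin n → ℝ) (v : ℝ) : Measure (Fin n → ℝ) :=
  Measure.pi fun i => gaussianReal (m i) v.toNNReal

/-- The sampling distribution of the data, `y ~ N_n(Xβ*, σ₀² I_n)`. -/
def dataDist {n p : ℕ} (X : Matrix (Fin n) (Fin p) ℝ) (βstar : Fin p → ℝ)
    (σ0sq : ℝ) : Measure (Fin n → ℝ) := gaussVec n (X.mulVec βstar) σ0sq

/-- Unnormalized marginal posterior model weight
`π(S)(γ/(α+γ))^{|S|/2}(b₀ + α‖y-ŷ_S‖²/2)^{-(a₀+αn/2)}`. -/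
def modelWt {n p : ℕ} (R : ℕ) (X : Matrix (Fin n) (Fin p) ℝ) (a₀ b₀ a c γ α : ℝ)
    (y : Fin n → ℝ) (S : Finset (Fin p)) : ℝ :=
  priorWt p R a c S * (γ / (α + γ)) ^ ((S.card : ℝ) / 2) *
    (b₀ + α / 2 * rss X S y) ^ (-(a₀ + α * n / 2))

/-- The marginal posterior probability `π^n(S)` of model `S`. -/
def postModel {n p : ℕ} (R : ℕ) (X : Matrix (Fin n) (Fin p) ℝ) (a₀ b₀ a c γ α : ℝ)
    (y : Fin n → ℝ) (S : Finset (Fin p)) : ℝ :=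
  modelWt R X a₀ b₀ a c γ α y S / ∑ S' : Finset (Fin p), modelWt R X a₀ b₀ a c γ α y S'

/-- The compatibility number `κ(s) = inf{‖Xβ‖₂/‖β‖₂ : 0 < |S_β| ≤ s}`. -/
def kappa {n p : ℕ} (X : Matrix (Fin n) (Fin p) ℝ) (s : ℝ) : ℝ :=
  sInf ((fun β : Fin p → ℝ =>
      Real.sqrt (∑ i, (X.mulVec β i) ^ 2) / Real.sqrt (∑ j, β j ^ 2)) ''
    {β | 0 < (Function.support β).ncard ∧ ((Function.support β).ncard : ℝ) ≤ s})

/-- Orthogonal projection `P_S = X_S(X_SᵀX_S)⁻¹X_Sᵀ` onto the column span of `X_S`. -/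
def projMat {n p : ℕ} (X : Matrix (Fin n) (Fin p) ℝ) (S : Finset (Fin p)) :
    Matrix (Fin n) (Fin n) ℝ := XS X S * (gram X S)⁻¹ * (XS X S)ᵀ

/-- Support of a coefficient vector as a `Finset`. -/
def suppFinset {p : ℕ} (β : Fin p → ℝ) : Finset (Fin p) :=
  Finset.univ.filter fun j => β j ≠ 0


/-- Squared Hellinger distance `H²(P,Q) = ∫ (√(dP/dν) − √(dQ/dν))² dν` with `ν = P + Q`. -/
def sqHellinger {E : Type*} [MeasurableSpace E] (P Q : Measure E) : ℝ :=
  ∫ x, (Real.sqrt ((P.rnDeriv (P + Q)) x).toReal -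
    Real.sqrt ((Q.rnDeriv (P + Q)) x).toReal) ^ 2 ∂(P + Q)

/-- Total variation distance `d_TV(P,Q) = sup_B |P(B) − Q(B)|`. -/
def tvDist {E : Type*} [MeasurableSpace E] (P Q : Measure E) : ℝ :=
  ⨆ A : {A : Set E // MeasurableSet A}, |(P A).toReal - (Q A).toReal|

/-- The Gaussian limit `N_{|S|}(β̂_S, (σ₀²/(α+γ))(X_SᵀX_S)⁻¹) ⊗ δ_{0,S^c}` on `ℝ^p`. -/
def gaussLimit {n p : ℕ} (X : Matrix (Fin n) (Fin p) ℝ) (S : Finset (Fin p))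
    (y : Fin n → ℝ) (σ0sq αγ : ℝ) : Measure (Fin p → ℝ) :=
  Measure.map (augment S)
    ((volume : Measure ({j // j ∈ S} → ℝ)).withDensity fun b =>
      ENNReal.ofReal ((2 * π * σ0sq / αγ) ^ (-(S.card : ℝ) / 2) *
        Real.sqrt ((gram X S).det) * Real.exp (-(αγ / (2 * σ0sq)) * quadForm X S y b)))

section GaussianMixture

variable {ι : Type*} [Fintype ι]

/-- Quadratic form `(b - m)ᵀ G (b - m)`. -/
def centeredQuad (G : Matrix ι ι ℝ) (m b : ι → ℝ) : ℝ := (b - m) ⬝ᵥ (G.mulVec (b - m))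

lemma continuous_centeredQuad (G : Matrix ι ι ℝ) (m : ι → ℝ) : Continuous (centeredQuad G m) := by
  unfold centeredQuad
  fun_prop

lemma centeredQuad_nonneg {G : Matrix ι ι ℝ} (hG : G.PosDef) (m b : ι → ℝ) :
    0 ≤ centeredQuad G m b := by
  have h := hG.posSemidef.dotProduct_mulVec_nonneg (b - m)
  rwa [star_trivial] at h

lemma lintegral_exp_neg_mul_sq_sum {κ : ℝ} (hκ : 0 < κ) :
    ∫⁻ x : ι → ℝ, ENNReal.ofReal (exp (-(κ / 2) * ∑ i, x i ^ 2)) =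
      ENNReal.ofReal ((2 * π / κ) ^ ((Fintype.card ι : ℝ) / 2)) := by
  have h1 : ∀ x : ι → ℝ, exp (-(κ / 2) * ∑ i, x i ^ 2) = ∏ i, exp (-(κ / 2) * x i ^ 2) := by
    intro x
    rw [Finset.mul_sum, exp_sum]
  have hint : Integrable fun x : ι → ℝ => ∏ i, exp (-(κ / 2) * x i ^ 2) :=
    Integrable.fintype_prod (f := fun (_ : ι) (t : ℝ) => exp (-(κ / 2) * t ^ 2))
      fun _ => integrable_exp_neg_mul_sq (by positivity)
  simp_rw [h1]
  rw [← ofReal_integral_eq_lintegral_ofReal hint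
      (ae_of_all _ fun x => Finset.prod_nonneg fun i _ => (exp_pos _).le),
    integral_fintype_prod_volume_eq_pow (fun t : ℝ => exp (-(κ / 2) * t ^ 2)), integral_gaussian,
    sqrt_eq_rpow, ← rpow_natCast, ← rpow_mul (by positivity)]
  congr 2
  · field_simp
  · ring

open scoped MatrixOrder in
lemma exists_eq_transpose_mul_self {G : Matrix ι ι ℝ} (hG : G.PosDef) :
    ∃ L : Matrix ι ι ℝ, G = Lᵀ * L := by
  obtain ⟨B, hB⟩ := CStarAlgebra.nonneg_iff_eq_star_mul_self.mp hG.posSemidef.nonneg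
  exact ⟨B, by simpa [star_eq_conjTranspose] using hB⟩

variable [DecidableEq ι]

/-- Density of the Gaussian law with mean `m` and precision matrix `κ G`. -/
def gaussDens (G : Matrix ι ι ℝ) (m : ι → ℝ) (κ : ℝ) (b : ι → ℝ) : ℝ :=
  (κ / (2 * π)) ^ ((Fintype.card ι : ℝ) / 2) * √G.det * exp (-(κ / 2) * centeredQuad G m b)

/-- Density of the mixture over `t ∼ Gamma(M, r)` of Gaussian laws with precision `t κ G`. -/
def studentDens (G : Matrix ι ι ℝ) (m : ι → ℝ) (κ M r : ℝ) (b : ι → ℝ) : ℝ :=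
  (κ / (2 * π)) ^ ((Fintype.card ι : ℝ) / 2) * √G.det *
    (Gamma (M + (Fintype.card ι : ℝ) / 2) / Gamma M) * r ^ M *
    (r + κ / 2 * centeredQuad G m b) ^ (-(M + (Fintype.card ι : ℝ) / 2))

lemma measurable_gaussDens (G : Matrix ι ι ℝ) (m : ι → ℝ) :
    Measurable fun x : ℝ × (ι → ℝ) => gaussDens G m x.1 x.2 := by
  unfold gaussDens
  have := (continuous_centeredQuad G m).measurable
  fun_prop

lemma lintegral_gaussDens {G : Matrix ι ι ℝ} (hG : G.PosDef) (m : ι → ℝ) {κ : ℝ} (hκ : 0 < κ) :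
    ∫⁻ b, ENNReal.ofReal (gaussDens G m κ b) = 1 := by
  obtain ⟨L, hL⟩ := exists_eq_transpose_mul_self hG
  have hdet : G.det = L.det ^ 2 := by rw [hL, det_mul, det_transpose, sq]
  have hLdet : L.det ≠ 0 := by
    intro h
    have := hG.det_pos
    rw [hdet, h] at this
    simp at this
  have hQ : ∀ b, centeredQuad G m b = ∑ i, (L.toLin' (b - m)) i ^ 2 := by
    intro b
    simp only [centeredQuad, hL, toLin'_apply, ← mulVec_mulVec]
    rw [dotProduct_mulVec, vecMul_transpose, dotProduct]
    simp_rw [sq]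
  have hmeas : Measurable fun x : ι → ℝ => ENNReal.ofReal (exp (-(κ / 2) * ∑ i, x i ^ 2)) := by
    fun_prop
  have hmain : ∫⁻ b : ι → ℝ, ENNReal.ofReal (exp (-(κ / 2) * centeredQuad G m b)) =
      ENNReal.ofReal |L.det⁻¹| * ENNReal.ofReal ((2 * π / κ) ^ ((Fintype.card ι : ℝ) / 2)) := by
    simp_rw [hQ]
    rw [lintegral_sub_right_eq_self (fun b : ι → ℝ =>
      ENNReal.ofReal (exp (-(κ / 2) * ∑ i, (L.toLin' b) i ^ 2))) m]
    rw [← lintegral_map hmeas (LinearMap.continuous_of_finiteDimensional _).measurable,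
      Real.map_matrix_volume_pi_eq_smul_volume_pi hLdet, lintegral_smul_measure,
      lintegral_exp_neg_mul_sq_sum hκ, smul_eq_mul]
  unfold gaussDens
  simp_rw [ENNReal.ofReal_mul (show 0 ≤ (κ / (2 * π)) ^ ((Fintype.card ι : ℝ) / 2) * √G.det by
    positivity)]
  rw [lintegral_const_mul' _ _ ENNReal.ofReal_ne_top, hmain, ← ENNReal.ofReal_mul (by positivity),
    ← ENNReal.ofReal_mul (by positivity), hdet, sqrt_sq_eq_abs, abs_inv]
  have h2 : (κ / (2 * π)) ^ ((Fintype.card ι : ℝ) / 2) *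
      (2 * π / κ) ^ ((Fintype.card ι : ℝ) / 2) = 1 := by
    rw [← mul_rpow (by positivity) (by positivity)]
    have : κ / (2 * π) * (2 * π / κ) = 1 := by
      field_simp
    rw [this, one_rpow]
  have h3 : |L.det| * |L.det|⁻¹ = 1 := mul_inv_cancel₀ (abs_ne_zero.2 hLdet)
  rw [show ∀ a b c d : ℝ, a * b * (c * d) = (a * d) * (b * c) by intros; ring, h2, h3]
  simp

lemma gaussDens_le {G : Matrix ι ι ℝ} (hG : G.PosDef) (m : ι → ℝ) {κ κ' : ℝ} (hκ : 0 < κ)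
    (h : κ ≤ κ') (b : ι → ℝ) :
    (κ / κ') ^ ((Fintype.card ι : ℝ) / 2) * gaussDens G m κ' b ≤ gaussDens G m κ b := by
  have hκ' : 0 < κ' := hκ.trans_le h
  unfold gaussDens
  rw [← mul_assoc, ← mul_assoc, ← mul_rpow (by positivity) (by positivity)]
  have : κ / κ' * (κ' / (2 * π)) = κ / (2 * π) := by field_simp
  rw [this]
  have := centeredQuad_nonneg hG m b
  gcongr

lemma one_sub_rpow_half_le (k : ℕ) {x : ℝ} (hx0 : 0 ≤ x) (hx1 : x ≤ 1) :
    1 - x ^ ((k : ℝ) / 2) ≤ k * (1 - x) := by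
  have h1 : x ^ (k : ℝ) ≤ x ^ ((k : ℝ) / 2) := by
    rcases k.eq_zero_or_pos with rfl | hk
    · simp
    · rcases hx0.eq_or_lt with rfl | hx
      · have : (k : ℝ) ≠ 0 := by positivity
        rw [zero_rpow this, zero_rpow (by positivity)]
      · exact rpow_le_rpow_of_exponent_ge hx hx1 (by
          have : (0 : ℝ) ≤ k := by positivity
          linarith)
  have h2 := one_add_mul_le_pow (show (-2 : ℝ) ≤ x - 1 by linarith) k
  rw [rpow_natCast] at h1
  have h3 : (1 + (x - 1)) ^ k = x ^ k := by ring_nf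
  rw [h3] at h2
  nlinarith

lemma measure_le_add_of_mul_le {E : Type*} [MeasurableSpace E] {P Q : Measure E}
    [IsProbabilityMeasure P] [IsProbabilityMeasure Q] {ρ : ℝ} (hρ0 : 0 ≤ ρ) (hρ1 : ρ ≤ 1)
    (h : ∀ A, MeasurableSet A → ENNReal.ofReal ρ * P A ≤ Q A) {A : Set E} (hA : MeasurableSet A) :
    P A ≤ Q A + ENNReal.ofReal (1 - ρ) ∧ Q A ≤ P A + ENNReal.ofReal (1 - ρ) := by
  have key : ∀ B, MeasurableSet B → ρ * P.real B ≤ Q.real B := by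
    intro B hB
    have := ENNReal.toReal_mono (measure_ne_top Q B) (h B hB)
    rwa [ENNReal.toReal_mul, ENNReal.toReal_ofReal hρ0] at this
  have h1 := key A hA
  have h2 := key Aᶜ hA.compl
  rw [probReal_compl_eq_one_sub hA, probReal_compl_eq_one_sub hA] at h2
  have h3 : P.real A ≤ 1 := measureReal_le_one
  have h4 : 0 ≤ P.real A := measureReal_nonneg
  rw [← ofReal_measureReal, ← ofReal_measureReal,
    ← ENNReal.ofReal_add (by positivity) (by linarith),
    ← ENNReal.ofReal_add (by positivity) (by linarith)]
  constructor <;> apply ENNReal.ofReal_le_ofReal <;> nlinarith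

/-- Gaussian measure with mean `m` and precision matrix `κ G`. -/
def gaussMeas (G : Matrix ι ι ℝ) (m : ι → ℝ) (κ : ℝ) : Measure (ι → ℝ) :=
  volume.withDensity fun b => ENNReal.ofReal (gaussDens G m κ b)

lemma isProbabilityMeasure_gaussMeas {G : Matrix ι ι ℝ} (hG : G.PosDef) (m : ι → ℝ) {κ : ℝ}
    (hκ : 0 < κ) : IsProbabilityMeasure (gaussMeas G m κ) :=
  ⟨by rw [gaussMeas, withDensity_apply _ MeasurableSet.univ, setLIntegral_univ,
    lintegral_gaussDens hG m hκ]⟩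

lemma gaussMeas_mul_le {G : Matrix ι ι ℝ} (hG : G.PosDef) (m : ι → ℝ) {κ κ' : ℝ}
    (hκ : 0 < κ) (h : κ ≤ κ') {A : Set (ι → ℝ)} (hA : MeasurableSet A) :
    ENNReal.ofReal ((κ / κ') ^ ((Fintype.card ι : ℝ) / 2)) * gaussMeas G m κ' A ≤
      gaussMeas G m κ A := by
  have hκ' : 0 < κ' := hκ.trans_le h
  rw [gaussMeas, gaussMeas, withDensity_apply _ hA, withDensity_apply _ hA,
    ← lintegral_const_mul' _ _ ENNReal.ofReal_ne_top]
  refine lintegral_mono fun b => ?_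
  rw [← ENNReal.ofReal_mul (by positivity)]
  exact ENNReal.ofReal_le_ofReal (gaussDens_le hG m hκ h b)

lemma gaussMeas_le_add {G : Matrix ι ι ℝ} (hG : G.PosDef) (m : ι → ℝ) {κ κ' : ℝ}
    (hκ : 0 < κ) (hκ' : 0 < κ') {A : Set (ι → ℝ)} (hA : MeasurableSet A) :
    gaussMeas G m κ A ≤
      gaussMeas G m κ' A + ENNReal.ofReal (Fintype.card ι * |κ / κ' - 1|) := by
  have := isProbabilityMeasure_gaussMeas hG m hκ
  have := isProbabilityMeasure_gaussMeas hG m hκ'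
  rcases le_total κ κ' with h | h
  · have hx : κ / κ' ≤ 1 := (div_le_one hκ').2 h
    refine (measure_le_add_of_mul_le (by positivity)
      (rpow_le_one (by positivity) hx (by positivity)) (fun A hA => gaussMeas_mul_le hG m hκ h hA) hA).2.trans ?_
    gcongr
    refine (one_sub_rpow_half_le _ (by positivity) hx).trans ?_
    gcongr
    rw [abs_sub_comm]
    exact le_abs_self _
  · have hx : κ' / κ ≤ 1 := (div_le_one hκ).2 h
    refine (measure_le_add_of_mul_le (by positivity)
      (rpow_le_one (by positivity) hx (by positivity)) (fun A hA => gaussMeas_mul_le hG m hκ' h hA) hA).1.trans ?_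
    gcongr
    refine (one_sub_rpow_half_le _ (by positivity) hx).trans ?_
    gcongr
    refine le_trans ?_ (le_abs_self _)
    rw [one_sub_div hκ.ne', div_sub_one hκ'.ne']
    have : 0 ≤ κ - κ' := by linarith
    gcongr

lemma measurable_gammaPDF (M r : ℝ) : Measurable (gammaPDF M r) :=
  (measurable_gammaPDFReal M r).ennreal_ofReal

lemma lintegral_gammaMeasure_gaussDens {G : Matrix ι ι ℝ} (hG : G.PosDef) (m : ι → ℝ)
    {κ M r : ℝ} (hκ : 0 < κ) (hM : 0 < M) (hr : 0 < r) (b : ι → ℝ) :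
    ∫⁻ t, ENNReal.ofReal (gaussDens G m (t * κ) b) ∂gammaMeasure M r =
      ENNReal.ofReal (studentDens G m κ M r b) := by
  have hQ := centeredQuad_nonneg hG m b
  have hr' : 0 < r + κ / 2 * centeredQuad G m b := by positivity
  have hM' : 0 < M + (Fintype.card ι : ℝ) / 2 := by positivity
  have hmeas : Measurable fun t : ℝ => ENNReal.ofReal (gaussDens G m (t * κ) b) :=
    ((measurable_gaussDens G m).comp
      ((measurable_id.mul_const κ).prodMk measurable_const)).ennreal_ofReal
  have hΓ := Gamma_pos_of_pos hM
  have hΓ' := Gamma_pos_of_pos hM'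
  have hst : 0 ≤ studentDens G m κ M r b := by
    unfold studentDens
    positivity
  have hpt : ∀ t : ℝ, t ≠ 0 → gammaPDF M r t * ENNReal.ofReal (gaussDens G m (t * κ) b) =
      ENNReal.ofReal (studentDens G m κ M r b) *
        gammaPDF (M + (Fintype.card ι : ℝ) / 2) (r + κ / 2 * centeredQuad G m b) t := by
    intro t ht
    rcases lt_or_gt_of_ne ht with ht | ht
    · rw [gammaPDF_of_neg ht, gammaPDF_of_neg ht, zero_mul, mul_zero]
    · rw [gammaPDF_of_nonneg ht.le, gammaPDF_of_nonneg ht.le,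
        ← ENNReal.ofReal_mul (by positivity), ← ENNReal.ofReal_mul hst]
      congr 1
      unfold gaussDens studentDens
      have e1 : (t * κ / (2 * π)) ^ ((Fintype.card ι : ℝ) / 2) =
          t ^ ((Fintype.card ι : ℝ) / 2) * (κ / (2 * π)) ^ ((Fintype.card ι : ℝ) / 2) := by
        rw [mul_div_assoc, mul_rpow ht.le (by positivity)]
      have e2 : t ^ (M + (Fintype.card ι : ℝ) / 2 - 1) =
          t ^ (M - 1) * t ^ ((Fintype.card ι : ℝ) / 2) := by
        rw [← rpow_add ht]
        ring_nf
      have e3 : exp (-((r + κ / 2 * centeredQuad G m b) * t)) =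
          exp (-(r * t)) * exp (-(t * κ / 2) * centeredQuad G m b) := by
        rw [← exp_add]
        ring_nf
      rw [e1, e2, e3, rpow_neg hr'.le]
      have := (rpow_pos_of_pos hr' (M + (Fintype.card ι : ℝ) / 2)).ne'
      field_simp
  rw [gammaMeasure, lintegral_withDensity_eq_lintegral_mul _
    (measurable_gammaPDF M r) hmeas]
  simp only [Pi.mul_apply]
  rw [lintegral_congr_ae (g := fun t => ENNReal.ofReal (studentDens G m κ M r b) *
      gammaPDF (M + (Fintype.card ι : ℝ) / 2) (r + κ / 2 * centeredQuad G m b) t),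
    lintegral_const_mul' _ _ ENNReal.ofReal_ne_top, lintegral_gammaPDF_eq_one hM' hr', mul_one]
  have h0 : ∀ᵐ t : ℝ, t ≠ 0 := by simp [ae_iff, measure_singleton]
  filter_upwards [h0] with t ht using hpt t ht

lemma gammaMeasure_ae_pos (M r : ℝ) : ∀ᵐ t ∂gammaMeasure M r, 0 < t := by
  have h0 : ∀ᵐ t : ℝ, t ≠ 0 := by simp [ae_iff, measure_singleton]
  rw [gammaMeasure, ae_withDensity_iff (measurable_gammaPDF M r)]
  filter_upwards [h0] with t ht h
  by_contra hneg
  exact h (gammaPDF_of_neg (lt_of_le_of_ne (not_lt.1 hneg) ht))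

lemma lintegral_gammaMeasure_mul {M r : ℝ} (hM : 0 < M) (hr : 0 < r) {f : ℝ → ℝ≥0∞}
    (hf : Measurable f) :
    ∫⁻ t, ENNReal.ofReal t * f t ∂gammaMeasure M r =
      ENNReal.ofReal (M / r) * ∫⁻ t, f t ∂gammaMeasure (M + 1) r := by
  rw [gammaMeasure, gammaMeasure, lintegral_withDensity_eq_lintegral_mul _
    (measurable_gammaPDF M r) (by fun_prop),
    lintegral_withDensity_eq_lintegral_mul _
    (measurable_gammaPDF (M + 1) r) hf,
    ← lintegral_const_mul' _ _ ENNReal.ofReal_ne_top]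
  have h0 : ∀ᵐ t : ℝ, t ≠ 0 := by simp [ae_iff, measure_singleton]
  refine lintegral_congr_ae ?_
  filter_upwards [h0] with t ht
  simp only [Pi.mul_apply]
  rw [← mul_assoc, ← mul_assoc]
  congr 1
  change gammaPDF M r t * _ = _ * gammaPDF (M + 1) r t
  rcases lt_or_gt_of_ne ht with ht | ht
  · rw [gammaPDF_of_neg ht, gammaPDF_of_neg ht, zero_mul, mul_zero]
  · have := Gamma_pos_of_pos hM
    rw [gammaPDF_of_nonneg ht.le, gammaPDF_of_nonneg ht.le,
      ← ENNReal.ofReal_mul (by positivity), ← ENNReal.ofReal_mul (by positivity),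
      Gamma_add_one hM.ne', rpow_add hr, rpow_one, add_sub_cancel_right, rpow_sub_one ht.ne']
    congr 1
    field_simp

lemma lintegral_gammaMeasure_abs_sub_le {M r : ℝ} (hM : 0 < M) (hr : 0 < r) :
    ∫⁻ t, ENNReal.ofReal |t - M / r| ∂gammaMeasure M r ≤ ENNReal.ofReal (√M / r) := by
  have := isProbabilityMeasure_gammaMeasure hM hr
  have := isProbabilityMeasure_gammaMeasure (a := M + 1) (by positivity) hr
  have := isProbabilityMeasure_gammaMeasure (a := M + 1 + 1) (by positivity) hr
  have hs : 0 < √M := sqrt_pos.2 hM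
  have hsq : √M ^ 2 = M := sq_sqrt hM.le
  have m1 : ∫⁻ t, ENNReal.ofReal t ∂gammaMeasure M r = ENNReal.ofReal (M / r) := by
    simpa using lintegral_gammaMeasure_mul hM hr (f := fun _ => 1) measurable_const
  have m1' : ∫⁻ t, ENNReal.ofReal t ∂gammaMeasure (M + 1) r = ENNReal.ofReal ((M + 1) / r) := by
    simpa using lintegral_gammaMeasure_mul (M := M + 1) (by positivity) hr (f := fun _ => 1)
      measurable_const
  have m2 : ∫⁻ t, ENNReal.ofReal t * ENNReal.ofReal t ∂gammaMeasure M r =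
      ENNReal.ofReal (M / r * ((M + 1) / r)) := by
    rw [lintegral_gammaMeasure_mul hM hr (by fun_prop), m1', ENNReal.ofReal_mul (by positivity)]
  have hpt : ∀ᵐ t ∂gammaMeasure M r,
      ENNReal.ofReal |t - M / r| + ENNReal.ofReal (√M) * ENNReal.ofReal t ≤
        ENNReal.ofReal (r / √M / 2) * (ENNReal.ofReal t * ENNReal.ofReal t) +
          ENNReal.ofReal (M * √M / r / 2 + √M / r / 2) := by
    filter_upwards [gammaMeasure_ae_pos M r] with t ht
    rw [← ENNReal.ofReal_mul (by positivity), ← ENNReal.ofReal_mul (by positivity),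
      ← ENNReal.ofReal_mul (by positivity), ← ENNReal.ofReal_add (by positivity) (by positivity),
      ← ENNReal.ofReal_add (by positivity) (by positivity)]
    apply ENNReal.ofReal_le_ofReal
    have h1 : 0 ≤ r / √M / 2 * (|t - M / r| - √M / r) ^ 2 := by positivity
    have h2 : r / √M / 2 * (|t - M / r| - √M / r) ^ 2 =
        r / √M / 2 * (|t - M / r| ^ 2) - |t - M / r| + √M / r / 2 := by
      field_simp
      ring
    rw [sq_abs] at h2
    have h3 : r / √M / 2 * (t - M / r) ^ 2 =
        r / √M / 2 * (t * t) - √M * t + M * √M / r / 2 := by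
      have : ∀ w > 0, w ^ 2 = M → r / w / 2 * (t - M / r) ^ 2 =
          r / w / 2 * (t * t) - w * t + M * w / r / 2 := by
        intro w hw hwM
        rw [← hwM]
        field_simp
        ring
      exact this _ hs hsq
    linarith
  have hint := lintegral_mono_ae hpt
  rw [lintegral_add_right _ (by fun_prop), lintegral_add_right _ (by fun_prop),
    lintegral_const_mul' _ _ ENNReal.ofReal_ne_top, lintegral_const_mul' _ _ ENNReal.ofReal_ne_top,
    m1, m2, lintegral_const, measure_univ, mul_one, ← ENNReal.ofReal_mul (by positivity),
    ← ENNReal.ofReal_mul (by positivity), ← ENNReal.ofReal_add (by positivity) (by positivity)]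
    at hint
  have heq : r / √M / 2 * (M / r * ((M + 1) / r)) + (M * √M / r / 2 + √M / r / 2) =
      √M / r + √M * (M / r) := by
    have : ∀ w > 0, w ^ 2 = M → r / w / 2 * (M / r * ((M + 1) / r)) +
        (M * w / r / 2 + w / r / 2) = w / r + w * (M / r) := by
      intro w hw hwM
      rw [← hwM]
      field_simp
      ring
    exact this _ hs hsq
  rw [heq, ENNReal.ofReal_add (by positivity) (by positivity)] at hint
  exact (ENNReal.add_le_add_iff_right ENNReal.ofReal_ne_top).1 hint

lemma setLIntegral_studentDens {G : Matrix ι ι ℝ} (hG : G.PosDef) (m : ι → ℝ)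
    {κ M r : ℝ} (hκ : 0 < κ) (hM : 0 < M) (hr : 0 < r) {A : Set (ι → ℝ)} (hA : MeasurableSet A) :
    ∫⁻ b in A, ENNReal.ofReal (studentDens G m κ M r b) =
      ∫⁻ t, gaussMeas G m (t * κ) A ∂gammaMeasure M r := by
  have := isProbabilityMeasure_gammaMeasure hM hr
  simp_rw [← lintegral_gammaMeasure_gaussDens hG m hκ hM hr, gaussMeas, withDensity_apply _ hA]
  refine lintegral_lintegral_swap (Measurable.aemeasurable ?_)
  exact ((measurable_gaussDens G m).comp
    ((measurable_snd.mul_const κ).prodMk measurable_fst)).ennreal_ofReal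

lemma lintegral_studentDens {G : Matrix ι ι ℝ} (hG : G.PosDef) (m : ι → ℝ)
    {κ M r : ℝ} (hκ : 0 < κ) (hM : 0 < M) (hr : 0 < r) :
    ∫⁻ b, ENNReal.ofReal (studentDens G m κ M r b) = 1 := by
  have := isProbabilityMeasure_gammaMeasure hM hr
  rw [← setLIntegral_univ, setLIntegral_studentDens hG m hκ hM hr MeasurableSet.univ,
    lintegral_congr_ae (g := fun _ => 1), lintegral_const, measure_univ, one_mul]
  filter_upwards [gammaMeasure_ae_pos M r] with t ht
  exact (isProbabilityMeasure_gaussMeas hG m (mul_pos ht hκ)).measure_univ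

lemma setLIntegral_studentDens_le {G : Matrix ι ι ℝ} (hG : G.PosDef) (m : ι → ℝ)
    {κ M r v : ℝ} (hκ : 0 < κ) (hM : 0 < M) (hr : 0 < r) (hv : 0 < v) {A : Set (ι → ℝ)}
    (hA : MeasurableSet A) :
    ∫⁻ b in A, ENNReal.ofReal (studentDens G m κ M r b) ≤ gaussMeas G m (κ / v) A +
      ENNReal.ofReal (Fintype.card ι * (v * √M / r + |v * M / r - 1|)) := by
  have := isProbabilityMeasure_gammaMeasure hM hr
  rw [setLIntegral_studentDens hG m hκ hM hr hA]
  have hpt : ∀ᵐ t ∂gammaMeasure M r, gaussMeas G m (t * κ) A ≤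
      (gaussMeas G m (κ / v) A + ENNReal.ofReal (Fintype.card ι * |v * M / r - 1|)) +
        ENNReal.ofReal (Fintype.card ι * v) * ENNReal.ofReal |t - M / r| := by
    filter_upwards [gammaMeasure_ae_pos M r] with t ht
    refine (gaussMeas_le_add hG m (mul_pos ht hκ) (div_pos hκ hv) hA).trans ?_
    rw [add_assoc, ← ENNReal.ofReal_mul (by positivity),
      ← ENNReal.ofReal_add (by positivity) (by positivity)]
    gcongr
    have h1 : t * κ / (κ / v) - 1 = v * (t - M / r) + (v * M / r - 1) := by
      field_simp
      ring
    have h2 : |v * (t - M / r) + (v * M / r - 1)| ≤ v * |t - M / r| + |v * M / r - 1| := by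
      refine (abs_add_le _ _).trans_eq ?_
      rw [abs_mul, abs_of_pos hv]
    rw [h1]
    have hc : (0 : ℝ) ≤ Fintype.card ι := by positivity
    nlinarith [mul_le_mul_of_nonneg_left h2 hc]
  refine (lintegral_mono_ae hpt).trans ?_
  rw [lintegral_add_left measurable_const, lintegral_const, measure_univ, mul_one,
    lintegral_const_mul' _ _ ENNReal.ofReal_ne_top]
  refine (add_le_add_right (mul_le_mul_right (lintegral_gammaMeasure_abs_sub_le hM hr) _)
    _).trans ?_
  rw [add_assoc, ← ENNReal.ofReal_mul (by positivity),
    ← ENNReal.ofReal_add (by positivity) (by positivity)]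
  refine le_of_eq ?_
  congr 2
  ring

end GaussianMixture

section Distances

variable {E : Type*} [MeasurableSpace E]

lemma measureReal_le_of_measure_le {P Q : Measure E} [IsProbabilityMeasure P]
    [IsProbabilityMeasure Q] {ε : ℝ} (hε : 0 ≤ ε)
    (h : ∀ A, MeasurableSet A → P A ≤ Q A + ENNReal.ofReal ε) {A : Set E} (hA : MeasurableSet A) :
    P.real A ≤ Q.real A + ε := by
  have := ENNReal.toReal_mono (by finiteness) (h A hA)
  rwa [ENNReal.toReal_add (by finiteness) (by finiteness), ENNReal.toReal_ofReal hε] at this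

lemma abs_measureReal_sub_le {P Q : Measure E} [IsProbabilityMeasure P]
    [IsProbabilityMeasure Q] {ε : ℝ} (hε : 0 ≤ ε)
    (h : ∀ A, MeasurableSet A → P A ≤ Q A + ENNReal.ofReal ε) {A : Set E} (hA : MeasurableSet A) :
    |P.real A - Q.real A| ≤ ε := by
  have h1 := measureReal_le_of_measure_le hε h hA
  have h2 := measureReal_le_of_measure_le hε h hA.compl
  rw [probReal_compl_eq_one_sub hA, probReal_compl_eq_one_sub hA] at h2
  rw [abs_le]
  constructor <;> linarith

lemma tvDist_nonneg (P Q : Measure E) : 0 ≤ tvDist P Q :=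
  Real.iSup_nonneg fun _ => abs_nonneg _

lemma sqHellinger_nonneg (P Q : Measure E) : 0 ≤ sqHellinger P Q :=
  integral_nonneg fun _ => sq_nonneg _

lemma tvDist_le {P Q : Measure E} [IsProbabilityMeasure P] [IsProbabilityMeasure Q] {ε : ℝ}
    (hε : 0 ≤ ε) (h : ∀ A, MeasurableSet A → P A ≤ Q A + ENNReal.ofReal ε) : tvDist P Q ≤ ε :=
  Real.iSup_le (fun A => abs_measureReal_sub_le hε h A.2) hε

lemma sq_sqrt_sub_sqrt_le {x y : ℝ} (hx : 0 ≤ x) (hy : 0 ≤ y) : (√x - √y) ^ 2 ≤ |x - y| := by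
  have h : |x - y| = |√x - √y| * (√x + √y) := by
    rw [← abs_of_nonneg (show 0 ≤ √x + √y by positivity), ← abs_mul]
    congr 1
    nlinarith [sq_sqrt hx, sq_sqrt hy]
  rw [h, ← sq_abs, sq]
  gcongr
  rw [abs_le]
  constructor <;> linarith [sqrt_nonneg x, sqrt_nonneg y]

lemma sqHellinger_le {P Q : Measure E} [IsProbabilityMeasure P] [IsProbabilityMeasure Q] {ε : ℝ}
    (hε : 0 ≤ ε) (h : ∀ A, MeasurableSet A → P A ≤ Q A + ENNReal.ofReal ε) :
    sqHellinger P Q ≤ 2 * ε := by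
  set f := fun x => ((P.rnDeriv (P + Q)) x).toReal
  set g := fun x => ((Q.rnDeriv (P + Q)) x).toReal
  have hfi : Integrable f (P + Q) := Measure.integrable_toReal_rnDeriv
  have hgi : Integrable g (P + Q) := Measure.integrable_toReal_rnDeriv
  have hPac : P ≪ P + Q := Measure.AbsolutelyContinuous.rfl.add_right Q
  have hQac : Q ≪ P + Q := by
    rw [add_comm]
    exact Measure.AbsolutelyContinuous.rfl.add_right P
  have hA : MeasurableSet {x | g x ≤ f x} :=
    measurableSet_le (Measure.measurable_rnDeriv _ _).ennreal_toReal
      (Measure.measurable_rnDeriv _ _).ennreal_toReal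
  have hle : sqHellinger P Q ≤ ∫ x, |f x - g x| ∂(P + Q) :=
    integral_mono_of_nonneg (ae_of_all _ fun _ => sq_nonneg _) (hfi.sub hgi).abs
      (ae_of_all _ fun _ => sq_sqrt_sub_sqrt_le ENNReal.toReal_nonneg ENNReal.toReal_nonneg)
  have e1 : ∫ x in {x | g x ≤ f x}, |f x - g x| ∂(P + Q) =
      P.real {x | g x ≤ f x} - Q.real {x | g x ≤ f x} := by
    rw [← Measure.setIntegral_toReal_rnDeriv hPac, ← Measure.setIntegral_toReal_rnDeriv hQac,
      ← integral_sub hfi.integrableOn hgi.integrableOn]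
    exact setIntegral_congr_fun hA fun x hx => abs_of_nonneg (sub_nonneg.2 hx)
  have e2 : ∫ x in {x | g x ≤ f x}ᶜ, |f x - g x| ∂(P + Q) =
      Q.real {x | g x ≤ f x}ᶜ - P.real {x | g x ≤ f x}ᶜ := by
    rw [← Measure.setIntegral_toReal_rnDeriv hPac, ← Measure.setIntegral_toReal_rnDeriv hQac,
      ← integral_sub hgi.integrableOn hfi.integrableOn]
    refine setIntegral_congr_fun hA.compl fun x hx => ?_
    have : f x < g x := not_le.1 hx
    rw [abs_of_neg (by linarith), neg_sub]
  have habs : Integrable (fun x => |f x - g x|) (P + Q) := (hfi.sub hgi).abs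
  rw [← integral_add_compl hA habs, e1, e2] at hle
  have h1 := abs_le.1 (abs_measureReal_sub_le hε h hA)
  have h2 := abs_le.1 (abs_measureReal_sub_le hε h hA.compl)
  linarith [h1.2, h2.1]

variable {κ : Type*} [Fintype κ]

lemma isProbabilityMeasure_normalized_sum {μ : κ → Measure E} {w : κ → ℝ} (hw : ∀ i, 0 ≤ w i)
    (hμ : ∀ i, μ i Set.univ = ENNReal.ofReal (w i)) {i₀ : κ} (h₀ : 0 < w i₀) :
    IsProbabilityMeasure (((∑ i, μ i) Set.univ)⁻¹ • ∑ i, μ i) := by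
  have hsum : 0 < ∑ i, w i := Finset.sum_pos' (fun i _ => hw i) ⟨i₀, Finset.mem_univ _, h₀⟩
  have hW : (∑ i, μ i) Set.univ = ENNReal.ofReal (∑ i, w i) := by
    rw [Measure.finsetSum_apply, ENNReal.ofReal_sum_of_nonneg fun i _ => hw i]
    simp_rw [hμ]
  refine ⟨?_⟩
  rw [Measure.smul_apply, smul_eq_mul, hW]
  exact ENNReal.inv_mul_cancel (by simpa using hsum) ENNReal.ofReal_ne_top

lemma normalized_sum_apply_le {μ : κ → Measure E} {w : κ → ℝ} (hw : ∀ i, 0 ≤ w i)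
    (hμ : ∀ i, μ i Set.univ = ENNReal.ofReal (w i)) {i₀ : κ} (h₀ : 0 < w i₀) {A : Set E}
    {x : ℝ≥0∞} (h : μ i₀ A ≤ ENNReal.ofReal (w i₀) * x) :
    (((∑ i, μ i) Set.univ)⁻¹ • ∑ i, μ i) A ≤ x + ENNReal.ofReal (1 - w i₀ / ∑ i, w i) := by
  have hsum : 0 < ∑ i, w i := Finset.sum_pos' (fun i _ => hw i) ⟨i₀, Finset.mem_univ _, h₀⟩
  have hle : w i₀ ≤ ∑ i, w i := Finset.single_le_sum (fun i _ => hw i) (Finset.mem_univ i₀)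
  have hW : (∑ i, μ i) Set.univ = ENNReal.ofReal (∑ i, w i) := by
    rw [Measure.finsetSum_apply, ENNReal.ofReal_sum_of_nonneg fun i _ => hw i]
    simp_rw [hμ]
  rw [Measure.smul_apply, smul_eq_mul, hW, Measure.finsetSum_apply,
    ← Finset.add_sum_erase _ (fun i => μ i A) (Finset.mem_univ i₀), mul_add,
    ← ENNReal.ofReal_inv_of_pos hsum]
  gcongr
  · calc ENNReal.ofReal (∑ i, w i)⁻¹ * μ i₀ A
        ≤ ENNReal.ofReal (∑ i, w i)⁻¹ * (ENNReal.ofReal (w i₀) * x) := by gcongr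
      _ = ENNReal.ofReal ((∑ i, w i)⁻¹ * w i₀) * x := by
          rw [← mul_assoc, ENNReal.ofReal_mul (by positivity)]
      _ ≤ 1 * x := by
          gcongr
          rw [ENNReal.ofReal_le_one, inv_mul_le_one₀ hsum]
          exact hle
      _ = x := one_mul x
  · have h1 : 1 - w i₀ / ∑ i, w i = (∑ i, w i)⁻¹ * ∑ i ∈ Finset.univ.erase i₀, w i := by
      rw [← Finset.add_sum_erase _ w (Finset.mem_univ i₀)] at hsum ⊢
      field_simp
      ring
    rw [h1, ENNReal.ofReal_mul (by positivity), ENNReal.ofReal_sum_of_nonneg fun i _ => hw i]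
    gcongr with i
    rw [← hμ]
    exact measure_mono (Set.subset_univ _)

end Distances

section Posterior

variable {n p : ℕ}

lemma quadForm_eq (X : Matrix (Fin n) (Fin p) ℝ) (S : Finset (Fin p)) (y : Fin n → ℝ) :
    quadForm X S y = centeredQuad (gram X S) (betaHat X S y) := rfl

lemma gram_posDef {X : Matrix (Fin n) (Fin p) ℝ} {S : Finset (Fin p)}
    (h : IsUnit (gram X S).det) : (gram X S).PosDef := by
  have h1 : (gram X S).PosSemidef := by
    have := posSemidef_conjTranspose_mul_self (XS X S)
    rwa [conjTranspose_eq_transpose_of_trivial] at this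
  exact h1.posDef_iff_isUnit.2 ((isUnit_iff_isUnit_det _).2 h)

lemma rss_nonneg (X : Matrix (Fin n) (Fin p) ℝ) (S : Finset (Fin p)) (y : Fin n → ℝ) :
    0 ≤ rss X S y := Finset.sum_nonneg fun _ _ => sq_nonneg _

lemma measurable_augment (S : Finset (Fin p)) : Measurable (augment S) := by
  refine measurable_pi_lambda _ fun j => ?_
  unfold augment
  split_ifs with h
  · exact measurable_pi_apply _
  · exact measurable_const

lemma priorWt_nonneg (p R : ℕ) (a : ℝ) {c : ℝ} (hc : 0 < c) (S : Finset (Fin p)) :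
    0 ≤ priorWt p R a c S := by
  unfold priorWt
  split_ifs <;> positivity

lemma priorWt_pos {p R : ℕ} (a : ℝ) {c : ℝ} (hc : 0 < c) (hp : 0 < p) {S : Finset (Fin p)}
    (hS : S.card ≤ R) : 0 < priorWt p R a c S := by
  unfold priorWt
  rw [if_pos hS]
  have : 0 < p.choose S.card := Nat.choose_pos (by simpa using S.card_le_univ)
  positivity

variable {R : ℕ} {X : Matrix (Fin n) (Fin p) ℝ} {a₀ b₀ a c γ α : ℝ}

lemma modelWt_nonneg (hb₀ : 0 < b₀) (hc : 0 < c) (hγ : 0 < γ) (hα : 0 < α) (y : Fin n → ℝ)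
    (S : Finset (Fin p)) : 0 ≤ modelWt R X a₀ b₀ a c γ α y S := by
  have := rss_nonneg X S y
  have := priorWt_nonneg p R a hc S
  unfold modelWt
  positivity

lemma modelWt_pos (hb₀ : 0 < b₀) (hc : 0 < c) (hγ : 0 < γ) (hα : 0 < α) (hp : 0 < p)
    (y : Fin n → ℝ) {S : Finset (Fin p)} (hS : S.card ≤ R) :
    0 < modelWt R X a₀ b₀ a c γ α y S := by
  have := rss_nonneg X S y
  have := priorWt_pos a hc hp hS
  unfold modelWt
  positivity

lemma Ddens_eq (ha₀ : 0 < a₀) (hb₀ : 0 < b₀) (hγ : 0 < γ) (hα : 0 < α)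
    (y : Fin n → ℝ) {S : Finset (Fin p)} (b : {j // j ∈ S} → ℝ) :
    Ddens R X a₀ b₀ a c γ α y S b =
      Gamma (a₀ + α * n / 2) * modelWt R X a₀ b₀ a c γ α y S *
        studentDens (gram X S) (betaHat X S y) (α + γ) (a₀ + α * n / 2)
          (b₀ + α / 2 * rss X S y) b := by
  have hr : 0 < b₀ + α / 2 * rss X S y := by
    have := rss_nonneg X S y
    positivity
  have hΓ : 0 < Gamma (a₀ + α * n / 2) := Gamma_pos_of_pos (by positivity)
  have hN : tExp n α a₀ S.card = a₀ + α * n / 2 + (S.card : ℝ) / 2 := by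
    unfold tExp
    ring
  unfold Ddens modelWt studentDens
  rw [hN, quadForm_eq, Fintype.card_coe, det_smul, Fintype.card_coe, sqrt_mul (by positivity),
    div_rpow hγ.le (by positivity), div_rpow (by positivity) (by positivity),
    neg_div, rpow_neg (by positivity) ((S.card : ℝ) / 2), rpow_neg hr.le,
    add_right_comm b₀ ((α + γ) / 2 * _), sqrt_eq_rpow (γ ^ S.card), ← rpow_natCast γ,
    ← rpow_mul hγ.le, mul_one_div]
  have hrM := (rpow_pos_of_pos hr (a₀ + α * n / 2)).ne'
  generalize (b₀ + α / 2 * rss X S y) ^ (a₀ + α * n / 2) = q at hrM ⊢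
  field_simp

lemma modelMeasure_apply (ha₀ : 0 < a₀) (hb₀ : 0 < b₀) (hc : 0 < c) (hγ : 0 < γ) (hα : 0 < α)
    (y : Fin n → ℝ) (S : Finset (Fin p)) {A : Set (Fin p → ℝ)}
    (hA : MeasurableSet A) :
    modelMeasure R X a₀ b₀ a c γ α y S A =
      ENNReal.ofReal (Gamma (a₀ + α * n / 2) * modelWt R X a₀ b₀ a c γ α y S) *
        ∫⁻ b in augment S ⁻¹' A, ENNReal.ofReal (studentDens (gram X S) (betaHat X S y) (α + γ)
          (a₀ + α * n / 2) (b₀ + α / 2 * rss X S y) b) := by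
  have hw : 0 ≤ Gamma (a₀ + α * n / 2) * modelWt R X a₀ b₀ a c γ α y S :=
    mul_nonneg (Gamma_nonneg_of_nonneg (by positivity)) (modelWt_nonneg hb₀ hc hγ hα y S)
  rw [modelMeasure, Measure.map_apply (measurable_augment S) hA,
    withDensity_apply _ (measurable_augment S hA), ← lintegral_const_mul' _ _ ENNReal.ofReal_ne_top]
  simp_rw [Ddens_eq ha₀ hb₀ hγ hα y, ENNReal.ofReal_mul hw]

lemma modelMeasure_univ (ha₀ : 0 < a₀) (hb₀ : 0 < b₀) (hc : 0 < c) (hγ : 0 < γ) (hα : 0 < α)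
    (hinv : ∀ S : Finset (Fin p), S.card ≤ R → IsUnit (gram X S).det)
    (y : Fin n → ℝ) (S : Finset (Fin p)) :
    modelMeasure R X a₀ b₀ a c γ α y S Set.univ =
      ENNReal.ofReal (Gamma (a₀ + α * n / 2) * modelWt R X a₀ b₀ a c γ α y S) := by
  by_cases hS : S.card ≤ R
  · have := rss_nonneg X S y
    rw [modelMeasure_apply ha₀ hb₀ hc hγ hα y S MeasurableSet.univ,
      Set.preimage_univ, setLIntegral_univ, lintegral_studentDens (gram_posDef (hinv S hS)) _
        (by positivity) (by positivity) (by positivity), mul_one]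
  · rw [modelMeasure, Measure.map_apply (measurable_augment S) MeasurableSet.univ]
    simp [Ddens, modelWt, priorWt, hS]

lemma gaussLimit_eq {S : Finset (Fin p)} (y : Fin n → ℝ) {v κ : ℝ} (hv : 0 < v) (hκ : 0 < κ) :
    gaussLimit X S y v κ =
      Measure.map (augment S) (gaussMeas (gram X S) (betaHat X S y) (κ / v)) := by
  unfold gaussLimit gaussMeas gaussDens
  rw [quadForm_eq, Fintype.card_coe, neg_div, rpow_neg (by positivity),
    ← inv_rpow (by positivity)]
  congr 3
  ext b
  congr 3
  · congr 1
    field_simp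
  · field_simp

lemma isProbabilityMeasure_gaussLimit {S : Finset (Fin p)} (hG : (gram X S).PosDef)
    (y : Fin n → ℝ) {v κ : ℝ} (hv : 0 < v) (hκ : 0 < κ) :
    IsProbabilityMeasure (gaussLimit X S y v κ) := by
  rw [gaussLimit_eq y hv hκ]
  have := isProbabilityMeasure_gaussMeas hG (betaHat X S y) (div_pos hκ hv)
  exact Measure.isProbabilityMeasure_map (measurable_augment S).aemeasurable

lemma isProbabilityMeasure_post (ha₀ : 0 < a₀) (hb₀ : 0 < b₀) (hc : 0 < c) (hγ : 0 < γ)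
    (hα : 0 < α) (hp : 0 < p) (hinv : ∀ S : Finset (Fin p), S.card ≤ R → IsUnit (gram X S).det)
    (y : Fin n → ℝ) : IsProbabilityMeasure (post R X a₀ b₀ a c γ α y) := by
  have hΓ : 0 < Gamma (a₀ + α * n / 2) := Gamma_pos_of_pos (by positivity)
  exact isProbabilityMeasure_normalized_sum
    (fun S => mul_nonneg hΓ.le (modelWt_nonneg hb₀ hc hγ hα y S))
    (modelMeasure_univ ha₀ hb₀ hc hγ hα hinv y) (i₀ := ∅)
    (mul_pos hΓ (modelWt_pos hb₀ hc hγ hα hp y (by simp)))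

lemma postModel_mem_Icc (hb₀ : 0 < b₀) (hc : 0 < c) (hγ : 0 < γ) (hα : 0 < α) (y : Fin n → ℝ)
    (S : Finset (Fin p)) : postModel R X a₀ b₀ a c γ α y S ∈ Set.Icc 0 1 := by
  have hw := modelWt_nonneg (R := R) (X := X) (a₀ := a₀) (a := a) hb₀ hc hγ hα y
  exact ⟨div_nonneg (hw S) (Finset.sum_nonneg fun i _ => hw i),
    div_le_one_of_le₀ (Finset.single_le_sum (fun i _ => hw i) (Finset.mem_univ S))
      (Finset.sum_nonneg fun i _ => hw i)⟩

lemma post_apply_le (ha₀ : 0 < a₀) (hb₀ : 0 < b₀) (hc : 0 < c) (hγ : 0 < γ)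
    (hα : 0 < α) (hp : 0 < p) (hinv : ∀ S : Finset (Fin p), S.card ≤ R → IsUnit (gram X S).det)
    (y : Fin n → ℝ) {S : Finset (Fin p)} (hS : S.card ≤ R) {v δ : ℝ} (hv : 0 < v)
    (hδ0 : 0 ≤ δ)
    (hδ : min 1 (S.card * (v * √(a₀ + α * n / 2) / (b₀ + α / 2 * rss X S y) +
      |v * (a₀ + α * n / 2) / (b₀ + α / 2 * rss X S y) - 1|)) ≤ δ)
    {A : Set (Fin p → ℝ)} (hA : MeasurableSet A) :
    post R X a₀ b₀ a c γ α y A ≤ gaussLimit X S y v (α + γ) A +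
      ENNReal.ofReal (1 - postModel R X a₀ b₀ a c γ α y S + δ) := by
  have hG := gram_posDef (hinv S hS)
  have hrss := rss_nonneg X S y
  have hΓ : 0 < Gamma (a₀ + α * n / 2) := Gamma_pos_of_pos (by positivity)
  have hpost := postModel_mem_Icc (R := R) (X := X) (a₀ := a₀) (a := a) hb₀ hc hγ hα y S
  have hmeas := measurable_augment S hA
  have hst : ∫⁻ b in augment S ⁻¹' A, ENNReal.ofReal (studentDens (gram X S) (betaHat X S y)
      (α + γ) (a₀ + α * n / 2) (b₀ + α / 2 * rss X S y) b) ≤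
      gaussLimit X S y v (α + γ) A + ENNReal.ofReal δ := by
    rw [gaussLimit_eq y hv (by positivity), Measure.map_apply (measurable_augment S) hA]
    rcases min_le_iff.1 hδ with h | h
    · refine le_add_left ?_
      calc _ ≤ ∫⁻ b, ENNReal.ofReal (studentDens (gram X S) (betaHat X S y)
            (α + γ) (a₀ + α * n / 2) (b₀ + α / 2 * rss X S y) b) := setLIntegral_le_lintegral _ _
        _ = 1 := lintegral_studentDens hG _ (by positivity) (by positivity) (by positivity)
        _ ≤ _ := by simpa using h
    · refine (setLIntegral_studentDens_le hG _ (by positivity) (by positivity) (by positivity) hv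
        hmeas).trans ?_
      rw [Fintype.card_coe]
      gcongr
  have hdiv : postModel R X a₀ b₀ a c γ α y S =
      Gamma (a₀ + α * n / 2) * modelWt R X a₀ b₀ a c γ α y S /
        ∑ S', Gamma (a₀ + α * n / 2) * modelWt R X a₀ b₀ a c γ α y S' := by
    rw [← Finset.mul_sum, mul_div_mul_left _ _ hΓ.ne', postModel]
  rw [add_comm (1 - _), ENNReal.ofReal_add hδ0 (by linarith [hpost.2]), ← add_assoc, hdiv]
  refine normalized_sum_apply_le
    (fun S => mul_nonneg hΓ.le (modelWt_nonneg hb₀ hc hγ hα y S))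
    (modelMeasure_univ ha₀ hb₀ hc hγ hα hinv y)
    (mul_pos hΓ (modelWt_pos hb₀ hc hγ hα hp y hS)) ?_
  rw [modelMeasure_apply ha₀ hb₀ hc hγ hα y S hA]
  gcongr

end Posterior

section Projection

variable {n p : ℕ} {X : Matrix (Fin n) (Fin p) ℝ} {S : Finset (Fin p)}

lemma yHat_eq (X : Matrix (Fin n) (Fin p) ℝ) (S : Finset (Fin p)) (y : Fin n → ℝ) :
    yHat X S y = projMat X S *ᵥ y := by
  rw [yHat, betaHat, projMat, mulVec_mulVec, Matrix.mul_assoc]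

lemma projMat_mul_XS (h : IsUnit (gram X S).det) : projMat X S * XS X S = XS X S := by
  rw [projMat, Matrix.mul_assoc, ← gram, Matrix.mul_assoc, nonsing_inv_mul _ h, Matrix.mul_one]

lemma projMat_transpose (X : Matrix (Fin n) (Fin p) ℝ) (S : Finset (Fin p)) :
    (projMat X S)ᵀ = projMat X S := by
  have : (gram X S)ᵀ = gram X S := by simp [gram, transpose_mul]
  rw [projMat, transpose_mul, transpose_mul, transpose_transpose, transpose_nonsing_inv, this,
    Matrix.mul_assoc]

lemma projMat_mul_self (h : IsUnit (gram X S).det) :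
    projMat X S * projMat X S = projMat X S := by
  conv_lhs => rw [projMat.eq_1 X S]
  change projMat X S * (XS X S * (gram X S)⁻¹ * (XS X S)ᵀ) = _
  rw [← Matrix.mul_assoc, ← Matrix.mul_assoc, projMat_mul_XS h, projMat]

lemma sum_sq_projMat (h : IsUnit (gram X S).det) :
    ∑ i, ∑ j, projMat X S i j ^ 2 = S.card := by
  have h1 : (projMat X S * (projMat X S)ᵀ).trace = ∑ i, ∑ j, projMat X S i j ^ 2 := by
    simp only [trace, diag_apply, mul_apply, transpose_apply, sq]
  rw [← h1, projMat_transpose, projMat_mul_self h, projMat, trace_mul_comm, ← Matrix.mul_assoc,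
    ← gram, mul_nonsing_inv _ h, trace_one, Fintype.card_coe]

lemma mulVec_eq_XS_mulVec (X : Matrix (Fin n) (Fin p) ℝ) (β : Fin p → ℝ) :
    X *ᵥ β = XS X (suppFinset β) *ᵥ fun j => β j.1 := by
  ext i
  simp only [mulVec, dotProduct, XS, of_apply]
  rw [Finset.sum_coe_sort (suppFinset β) (fun j => X i j * β j)]
  refine (Finset.sum_subset (Finset.subset_univ _) fun j _ hj => ?_).symm
  have : β j = 0 := by simpa [suppFinset] using hj
  rw [this, mul_zero]

lemma rss_suppFinset_eq {β : Fin p → ℝ} (h : IsUnit (gram X (suppFinset β)).det) (y : Fin n → ℝ) :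
    rss X (suppFinset β) y = ∑ i, (y i - (X *ᵥ β) i) ^ 2 -
      ∑ i, (∑ j, projMat X (suppFinset β) i j * (y j - (X *ᵥ β) j)) ^ 2 := by
  obtain ⟨P, hP⟩ : ∃ P, P = projMat X (suppFinset β) := ⟨_, rfl⟩
  obtain ⟨z, hz⟩ : ∃ z, z = y - X *ᵥ β := ⟨_, rfl⟩
  have hPm : P *ᵥ (X *ᵥ β) = X *ᵥ β := by
    rw [mulVec_eq_XS_mulVec X β, mulVec_mulVec, hP, projMat_mul_XS h]
  have h1 : rss X (suppFinset β) y = (z - P *ᵥ z) ⬝ᵥ (z - P *ᵥ z) := by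
    have : y - yHat X (suppFinset β) y = z - P *ᵥ z := by
      rw [yHat_eq, hz, mulVec_sub, hPm, hP, sub_sub_sub_cancel_right]
    rw [← this]
    simp only [rss, dotProduct, Pi.sub_apply, sq]
  have h2 : (P *ᵥ z) ⬝ᵥ (P *ᵥ z) = z ⬝ᵥ (P *ᵥ z) := by
    have hPt : Pᵀ = P := hP ▸ projMat_transpose X _
    have hPP : P * P = P := hP ▸ projMat_mul_self h
    calc (P *ᵥ z) ⬝ᵥ (P *ᵥ z) = (z ᵥ* Pᵀ) ⬝ᵥ (P *ᵥ z) := by rw [vecMul_transpose]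
      _ = z ⬝ᵥ (P *ᵥ z) := by rw [hPt, ← dotProduct_mulVec, mulVec_mulVec, hPP]
  have h3 : ∑ i, (y i - (X *ᵥ β) i) ^ 2 = z ⬝ᵥ z := by
    simp only [hz, dotProduct, Pi.sub_apply, sq]
  have h4 : ∑ i, (∑ j, P i j * (y j - (X *ᵥ β) j)) ^ 2 = (P *ᵥ z) ⬝ᵥ (P *ᵥ z) := by
    simp only [hz, mulVec, dotProduct, Pi.sub_apply, sq]
  rw [← hP, h1, h3, h4, sub_dotProduct, dotProduct_sub, dotProduct_sub, h2,
    dotProduct_comm (P *ᵥ z) z]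
  ring

end Projection

section Noise

/-- Variance of the square of a standard Gaussian variable. -/
def chiSqVar : ℝ := Var[fun x => x ^ 2; gaussianReal 0 1]

variable {n : ℕ} {m : Fin n → ℝ} {v : ℝ}

lemma memLp_sub_gaussianReal (μ : ℝ) (w : ℝ≥0) {q : ℝ≥0∞} (hq : q ≠ ∞) :
    MemLp (fun x => x - μ) q (gaussianReal μ w) :=
  (memLp_id_gaussianReal' q hq).sub (memLp_const μ)

lemma memLp_sub_sq_gaussianReal (μ : ℝ) (w : ℝ≥0) :
    MemLp (fun x => (x - μ) ^ 2 - (w : ℝ)) 2 (gaussianReal μ w) := by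
  refine MemLp.sub ?_ (memLp_const _)
  have h := memLp_sub_gaussianReal μ w (q := 4) (by simp)
  have h2 : ENNReal.HolderTriple 4 4 2 := ⟨by
    rw [← two_mul]
    rw [show (4 : ℝ≥0∞) = 2 * 2 by norm_num, ENNReal.mul_inv (by simp) (by simp), ← mul_assoc,
      ENNReal.mul_inv_cancel (by simp) (by simp), one_mul]⟩
  simpa only [sq, Pi.mul_apply] using! h.mul' h

lemma integral_sub_gaussianReal (μ : ℝ) (w : ℝ≥0) : ∫ x, (x - μ) ∂gaussianReal μ w = 0 := by
  have h : Integrable (fun x => x) (gaussianReal μ w) :=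
    (memLp_id_gaussianReal' 1 (by simp)).integrable le_rfl
  rw [integral_sub h (integrable_const _)]
  simp

lemma integral_sub_sq_gaussianReal (μ : ℝ) (w : ℝ≥0) :
    ∫ x, (x - μ) ^ 2 ∂gaussianReal μ w = w := by
  have h := variance_id_gaussianReal (μ := μ) (v := w)
  rw [variance_eq_integral measurable_id.aemeasurable] at h
  simpa using h

lemma variance_sub_sq_gaussianReal (μ : ℝ) (w : ℝ≥0) :
    Var[fun x => (x - μ) ^ 2 - (w : ℝ); gaussianReal μ w] = (w : ℝ) ^ 2 * chiSqVar := by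
  have hmap : gaussianReal μ w = (gaussianReal 0 1).map fun x => √w * x + μ := by
    have h : (gaussianReal 0 1).map (fun x => √w * x + μ) =
        ((gaussianReal 0 1).map (√w * ·)).map (· + μ) := by
      rw [Measure.map_map (by fun_prop) (by fun_prop)]
      rfl
    rw [h, gaussianReal_map_const_mul, gaussianReal_map_add_const]
    congr 1
    · simp
    · ext
      simp
  rw [hmap, variance_map (by fun_prop) (by fun_prop), chiSqVar, ← variance_const_mul]
  have : (fun x => (x - μ) ^ 2 - (w : ℝ)) ∘ (fun x => √w * x + μ) =
      fun x => (w : ℝ) * x ^ 2 - w := by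
    ext x
    simp only [Function.comp_apply, add_sub_cancel_right, mul_pow, sq_sqrt w.coe_nonneg]
  rw [this, variance_sub_const]
  fun_prop

lemma integral_sq_linear_gaussVec (hv : 0 ≤ v) (l : Fin n → ℝ) :
    Integrable (fun y => (∑ j, l j * (y j - m j)) ^ 2) (gaussVec n m v) ∧
      ∫ y, (∑ j, l j * (y j - m j)) ^ 2 ∂gaussVec n m v = v * ∑ j, l j ^ 2 := by
  have hpr : IsProbabilityMeasure (gaussVec n m v) := by
    unfold gaussVec
    infer_instance
  have hmem : ∀ j, MemLp (fun x => l j * (x - m j)) 2 (gaussianReal (m j) v.toNNReal) :=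
    fun j => (memLp_sub_gaussianReal _ _ (by simp)).const_mul (l j)
  have hmem' : ∀ j, MemLp (fun y : Fin n → ℝ => l j * (y j - m j)) 2 (gaussVec n m v) :=
    fun j => (hmem j).comp_measurePreserving (measurePreserving_eval _ j)
  have hsum : MemLp (fun y : Fin n → ℝ => ∑ j, l j * (y j - m j)) 2 (gaussVec n m v) :=
    memLp_finsetSum _ fun j _ => hmem' j
  refine ⟨hsum.integrable_sq, ?_⟩
  have hmean : ∫ y, ∑ j, l j * (y j - m j) ∂gaussVec n m v = 0 := by
    rw [integral_finsetSum _ fun j _ => (hmem' j).integrable one_le_two]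
    refine Finset.sum_eq_zero fun j _ => ?_
    rw [gaussVec, integral_comp_eval (μ := fun i => gaussianReal (m i) v.toNNReal) (i := j)
      (f := fun x => l j * (x - m j)) (hmem j).aestronglyMeasurable, integral_const_mul,
      integral_sub_gaussianReal, mul_zero]
  rw [← variance_of_integral_eq_zero hsum.aemeasurable hmean]
  have h := variance_sum_pi (μ := fun i => gaussianReal (m i) v.toNNReal) hmem
  have e : (∑ j, fun y : Fin n → ℝ => l j * (y j - m j)) =
      fun y => ∑ j, l j * (y j - m j) := by
    ext y
    simp
  rw [e] at h
  rw [gaussVec, h, Finset.mul_sum]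
  refine Finset.sum_congr rfl fun j _ => ?_
  rw [variance_const_mul, variance_sub_const (by fun_prop)]
  have : Var[fun x => x; gaussianReal (m j) v.toNNReal] = _ := variance_id_gaussianReal
  rw [this, Real.coe_toNNReal _ hv]
  ring

lemma integral_abs_sum_sq_sub_gaussVec_le (hn : 0 < n) (hv : 0 < v) :
    Integrable (fun y => |∑ j, ((y j - m j) ^ 2 - v)|) (gaussVec n m v) ∧
      ∫ y, |∑ j, ((y j - m j) ^ 2 - v)| ∂gaussVec n m v ≤ v * √n * ((chiSqVar + 1) / 2) := by
  have hpr : IsProbabilityMeasure (gaussVec n m v) := by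
    unfold gaussVec
    infer_instance
  have hvv : (v.toNNReal : ℝ) = v := Real.coe_toNNReal _ hv.le
  have hmem : ∀ j, MemLp (fun x => (x - m j) ^ 2 - v) 2 (gaussianReal (m j) v.toNNReal) := by
    intro j
    simpa only [hvv] using memLp_sub_sq_gaussianReal (m j) v.toNNReal
  have hmem' : ∀ j, MemLp (fun y : Fin n → ℝ => (y j - m j) ^ 2 - v) 2 (gaussVec n m v) :=
    fun j => (hmem j).comp_measurePreserving (measurePreserving_eval _ j)
  have hsum : MemLp (fun y : Fin n → ℝ => ∑ j, ((y j - m j) ^ 2 - v)) 2 (gaussVec n m v) :=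
    memLp_finsetSum _ fun j _ => hmem' j
  have hint : Integrable (fun y : Fin n → ℝ => ∑ j, ((y j - m j) ^ 2 - v)) (gaussVec n m v) :=
    hsum.integrable one_le_two
  refine ⟨hint.abs, ?_⟩
  have hmean : ∫ y, ∑ j, ((y j - m j) ^ 2 - v) ∂gaussVec n m v = 0 := by
    rw [integral_finsetSum _ fun j _ => (hmem' j).integrable one_le_two]
    refine Finset.sum_eq_zero fun j _ => ?_
    rw [gaussVec, integral_comp_eval (μ := fun i => gaussianReal (m i) v.toNNReal) (i := j)
      (f := fun x => (x - m j) ^ 2 - v) (hmem j).aestronglyMeasurable,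
      integral_sub (memLp_sub_gaussianReal _ _ (by simp)).integrable_sq (integrable_const _),
      integral_sub_sq_gaussianReal, hvv]
    simp
  have hvar : ∫ y, (∑ j, ((y j - m j) ^ 2 - v)) ^ 2 ∂gaussVec n m v = n * (v ^ 2 * chiSqVar) := by
    rw [← variance_of_integral_eq_zero hsum.aemeasurable hmean]
    have h := variance_sum_pi (μ := fun i => gaussianReal (m i) v.toNNReal) hmem
    have e : (∑ j, fun y : Fin n → ℝ => (y j - m j) ^ 2 - v) =
        fun y => ∑ j, ((y j - m j) ^ 2 - v) := by
      ext y
      simp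
    rw [e] at h
    rw [gaussVec, h]
    have : ∀ j, Var[fun x => (x - m j) ^ 2 - v; gaussianReal (m j) v.toNNReal] =
        v ^ 2 * chiSqVar := by
      intro j
      simpa only [hvv] using variance_sub_sq_gaussianReal (m j) v.toNNReal
    simp_rw [this]
    simp
  have hq : 0 < v * √n := by positivity
  have hnsq : √(n : ℝ) ^ 2 = n := sq_sqrt (by positivity)
  calc ∫ y, |∑ j, ((y j - m j) ^ 2 - v)| ∂gaussVec n m v
      ≤ ∫ y, ((∑ j, ((y j - m j) ^ 2 - v)) ^ 2 * (1 / (2 * (v * √n))) + v * √n / 2)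
          ∂gaussVec n m v := by
        refine integral_mono hint.abs ((hsum.integrable_sq.mul_const _).add (integrable_const _))
          fun y => ?_
        simp only
        generalize v * √n = q at hq
        generalize ∑ j, ((y j - m j) ^ 2 - v) = x
        have h1 : x ^ 2 * (1 / (2 * q)) + q / 2 - |x| = (|x| - q) ^ 2 * (1 / (2 * q)) := by
          rw [sub_sq, sq_abs]
          field_simp
          ring
        have h2 : 0 ≤ (|x| - q) ^ 2 * (1 / (2 * q)) := by positivity
        linarith
    _ = v * √n * ((chiSqVar + 1) / 2) := by
        rw [integral_add (hsum.integrable_sq.mul_const _) (integrable_const _),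
          integral_mul_const, hvar]
        simp only [integral_const, probReal_univ, one_smul]
        nth_rewrite 1 [← hnsq]
        field_simp

end Noise

section Limit

/-- Bound on the total variation distance between the Student and the Gaussian conditional
posteriors of `s` coefficients, in terms of the deviation `e` of the residual sum of squares from
its noise level. -/
def condError (a₀ b₀ α v : ℝ) (n s : ℕ) (e : ℝ) : ℝ :=
  (2 * s + 2) * ((v * a₀ + b₀ + α / 2 * e) / (v * (a₀ + α * n / 2))) +
    2 * s / √(a₀ + α * n / 2)

/-- Bound on the deviation of the residual sum of squares of the true model from its noise level. -/
def rssError {n p : ℕ} (X : Matrix (Fin n) (Fin p) ℝ) (β : Fin p → ℝ) (v : ℝ) (y : Fin n → ℝ) :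
    ℝ :=
  |∑ j, ((y j - (X *ᵥ β) j) ^ 2 - v)| +
    ∑ i, (∑ j, projMat X (suppFinset β) i j * (y j - (X *ᵥ β) j)) ^ 2

lemma min_one_le_of_scale {s v M r : ℝ} (hs : 0 ≤ s) (hv : 0 < v) (hM : 0 < M) (hr : 0 < r) :
    min 1 (s * (v * √M / r + |v * M / r - 1|)) ≤
      (2 * s + 2) * (|v * M - r| / (v * M)) + 2 * s / √M := by
  have hvM : 0 < v * M := by positivity
  have hq : 0 < √M := sqrt_pos.2 hM
  obtain ⟨D, hD⟩ : ∃ D, D = |v * M - r| / (v * M) := ⟨_, rfl⟩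
  have hD0 : 0 ≤ D := by rw [hD]; positivity
  rw [← hD]
  rw [eq_div_iff hvM.ne'] at hD
  have hs0 : 0 ≤ 2 * s / √M := by positivity
  rcases le_total D (1 / 2) with h | h
  · refine (min_le_right _ _).trans ?_
    have h1 : v * M / 2 ≤ r := by
      have := le_abs_self (v * M - r)
      nlinarith
    have h2 : v * √M / r ≤ 2 / √M := by
      rw [div_le_div_iff₀ hr hq, mul_assoc, mul_self_sqrt hM.le]
      linarith
    have h3 : |v * M / r - 1| ≤ 2 * D := by
      rw [div_sub_one hr.ne', abs_div, abs_of_pos hr, div_le_iff₀ hr, ← hD]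
      nlinarith
    calc s * (v * √M / r + |v * M / r - 1|) ≤ s * (2 / √M + 2 * D) := by gcongr
      _ = 2 * s * D + 2 * s / √M := by ring
      _ ≤ _ := by linarith
  · refine (min_le_left _ _).trans ?_
    nlinarith

variable {n p R : ℕ} {X : Matrix (Fin n) (Fin p) ℝ} {β : Fin p → ℝ} {a₀ b₀ a c γ α v : ℝ}

lemma condError_nonneg (ha₀ : 0 < a₀) (hb₀ : 0 < b₀) (hα : 0 < α) (hv : 0 < v) (s : ℕ) {e : ℝ}
    (he : 0 ≤ e) : 0 ≤ condError a₀ b₀ α v n s e := by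
  unfold condError
  positivity

lemma rssError_nonneg (X : Matrix (Fin n) (Fin p) ℝ) (β : Fin p → ℝ) (v : ℝ) (y : Fin n → ℝ) :
    0 ≤ rssError X β v y := by
  unfold rssError
  positivity

lemma abs_sub_rss_le (h : IsUnit (gram X (suppFinset β)).det) (y : Fin n → ℝ) :
    |n * v - rss X (suppFinset β) y| ≤ rssError X β v y := by
  have hs : ∑ j, ((y j - (X *ᵥ β) j) ^ 2 - v) = ∑ j, (y j - (X *ᵥ β) j) ^ 2 - n * v := by
    simp [Finset.sum_sub_distrib]
  have hT : 0 ≤ ∑ i, (∑ j, projMat X (suppFinset β) i j * (y j - (X *ᵥ β) j)) ^ 2 := by positivity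
  rw [rss_suppFinset_eq h, rssError, hs]
  generalize ∑ j, (y j - (X *ᵥ β) j) ^ 2 = q
  generalize ∑ i, (∑ j, projMat X (suppFinset β) i j * (y j - (X *ᵥ β) j)) ^ 2 = t at hT
  have h1 := le_abs_self (q - n * v)
  have h2 := neg_abs_le (q - n * v)
  rw [abs_le]
  constructor <;> linarith

lemma min_one_le_condError (ha₀ : 0 < a₀) (hb₀ : 0 < b₀) (hα : 0 < α) (hv : 0 < v)
    (h : IsUnit (gram X (suppFinset β)).det) (y : Fin n → ℝ) (s : ℕ) :
    min 1 (s * (v * √(a₀ + α * n / 2) / (b₀ + α / 2 * rss X (suppFinset β) y) +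
      |v * (a₀ + α * n / 2) / (b₀ + α / 2 * rss X (suppFinset β) y) - 1|)) ≤
      condError a₀ b₀ α v n s (rssError X β v y) := by
  have hrss := rss_nonneg X (suppFinset β) y
  refine (min_one_le_of_scale s.cast_nonneg hv (by positivity) (by positivity)).trans ?_
  unfold condError
  have hd : |v * (a₀ + α * n / 2) - (b₀ + α / 2 * rss X (suppFinset β) y)| ≤
      v * a₀ + b₀ + α / 2 * rssError X β v y := by
    have h1 := abs_sub_rss_le (v := v) h y
    rw [abs_le] at h1 ⊢
    have h2 := mul_pos hv ha₀
    constructor <;> nlinarith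
  gcongr

lemma integral_rssError_le (hn : 0 < n) (hv : 0 < v) (h : IsUnit (gram X (suppFinset β)).det) :
    Integrable (rssError X β v) (dataDist X β v) ∧ ∫ y, rssError X β v y ∂dataDist X β v ≤
      v * √n * ((chiSqVar + 1) / 2) + v * (suppFinset β).card := by
  obtain ⟨hi, hle⟩ := integral_abs_sum_sq_sub_gaussVec_le (m := X *ᵥ β) hn hv
  have hP := fun i => integral_sq_linear_gaussVec (m := X *ᵥ β) hv.le (projMat X (suppFinset β) i)
  have hsum := integrable_finsetSum Finset.univ fun i _ => (hP i).1
  refine ⟨hi.add hsum, ?_⟩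
  simp only [rssError, dataDist]
  rw [integral_add hi hsum, integral_finsetSum _ fun i _ => (hP i).1]
  simp_rw [(hP _).2]
  rw [← Finset.mul_sum, sum_sq_projMat h]
  gcongr

lemma integral_le_of_le_condError (ha₀ : 0 < a₀) (hα : 0 < α) (hv : 0 < v)
    (hn : 0 < n) (h : IsUnit (gram X (suppFinset β)).det) (s : ℕ) {f g : (Fin n → ℝ) → ℝ}
    {k : ℝ} (hk : 0 ≤ k) (hf : ∀ y, 0 ≤ f y) (hg : Integrable g (dataDist X β v))
    (hfg : ∀ y, f y ≤ k * (1 - g y + condError a₀ b₀ α v n s (rssError X β v y))) :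
    ∫ y, f y ∂dataDist X β v ≤ k * (1 - ∫ y, g y ∂dataDist X β v + condError a₀ b₀ α v n s
      (v * √n * ((chiSqVar + 1) / 2) + v * (suppFinset β).card)) := by
  have hpr : IsProbabilityMeasure (dataDist X β v) := by
    unfold dataDist gaussVec
    infer_instance
  obtain ⟨hi, hle⟩ := integral_rssError_le hn hv h
  have hi' : Integrable (fun y => (2 * (s : ℝ) + 2) *
      ((v * a₀ + b₀ + α / 2 * rssError X β v y) / (v * (a₀ + α * n / 2)))) (dataDist X β v) :=
    (((integrable_const _).add (hi.const_mul _)).div_const _).const_mul _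
  have hc : Integrable (fun y => condError a₀ b₀ α v n s (rssError X β v y)) (dataDist X β v) :=
    hi'.add (integrable_const _)
  have hg' : Integrable (fun y => 1 - g y) (dataDist X β v) := (integrable_const _).sub hg
  have hic : ∫ y, condError a₀ b₀ α v n s (rssError X β v y) ∂dataDist X β v =
      condError a₀ b₀ α v n s (∫ y, rssError X β v y ∂dataDist X β v) := by
    simp only [condError]
    rw [integral_add hi' (integrable_const _), integral_const_mul, integral_div,
      integral_add (integrable_const _) (hi.const_mul _), integral_const_mul]
    simp
  calc ∫ y, f y ∂dataDist X β v
      ≤ ∫ y, k * (1 - g y + condError a₀ b₀ α v n s (rssError X β v y)) ∂dataDist X β v :=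
        integral_mono_of_nonneg (ae_of_all _ hf) ((hg'.add hc).const_mul k) (ae_of_all _ hfg)
    _ = k * (1 - ∫ y, g y ∂dataDist X β v +
          condError a₀ b₀ α v n s (∫ y, rssError X β v y ∂dataDist X β v)) := by
        rw [integral_const_mul, integral_add hg' hc, integral_sub (integrable_const _) hg, hic]
        simp
    _ ≤ _ := by
        unfold condError
        gcongr

/-- Expected Hellinger and total variation distances at a fixed sample size. -/
lemma integral_distances_le (ha₀ : 0 < a₀) (hb₀ : 0 < b₀) (hc : 0 < c) (hγ : 0 < γ) (hα : 0 < α)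
    (hv : 0 < v) (hn : 0 < n) (hp : 0 < p)
    (hinv : ∀ S : Finset (Fin p), S.card ≤ R → IsUnit (gram X S).det)
    (hS : (suppFinset β).card ≤ R)
    (hint : Integrable (fun y => postModel R X a₀ b₀ a c γ α y (suppFinset β)) (dataDist X β v)) :
    ∫ y, sqHellinger (post R X a₀ b₀ a c γ α y) (gaussLimit X (suppFinset β) y v (α + γ))
        ∂dataDist X β v ≤
      2 * (1 - ∫ y, postModel R X a₀ b₀ a c γ α y (suppFinset β) ∂dataDist X β v +
        condError a₀ b₀ α v n (suppFinset β).card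
          (v * √n * ((chiSqVar + 1) / 2) + v * (suppFinset β).card)) ∧
    ∫ y, tvDist (post R X a₀ b₀ a c γ α y) (gaussLimit X (suppFinset β) y v (α + γ))
        ∂dataDist X β v ≤
      1 * (1 - ∫ y, postModel R X a₀ b₀ a c γ α y (suppFinset β) ∂dataDist X β v +
        condError a₀ b₀ α v n (suppFinset β).card
          (v * √n * ((chiSqVar + 1) / 2) + v * (suppFinset β).card)) := by
  have hU := hinv _ hS
  have hP := isProbabilityMeasure_post (R := R) (X := X) (a := a) ha₀ hb₀ hc hγ hα hp hinv
  have hQ : ∀ y, IsProbabilityMeasure (gaussLimit X (suppFinset β) y v (α + γ)) := fun y =>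
    isProbabilityMeasure_gaussLimit (gram_posDef hU) y hv (by positivity)
  have hδ : ∀ y, 0 ≤ condError a₀ b₀ α v n (suppFinset β).card (rssError X β v y) := fun y =>
    condError_nonneg ha₀ hb₀ hα hv _ (rssError_nonneg X β v y)
  have hle := fun y (A : Set (Fin p → ℝ)) (hA : MeasurableSet A) =>
    post_apply_le (a := a) ha₀ hb₀ hc hγ hα hp hinv y hS hv (hδ y)
      (min_one_le_condError ha₀ hb₀ hα hv hU y _) hA
  have hε : ∀ y, 0 ≤ 1 - postModel R X a₀ b₀ a c γ α y (suppFinset β) +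
      condError a₀ b₀ α v n (suppFinset β).card (rssError X β v y) := fun y => by
    have := (postModel_mem_Icc (R := R) (X := X) (a₀ := a₀) (a := a) hb₀ hc hγ hα y
      (suppFinset β)).2
    linarith [hδ y]
  refine ⟨integral_le_of_le_condError ha₀ hα hv hn hU _ zero_le_two
      (fun y => sqHellinger_nonneg _ _) hint fun y => ?_,
    integral_le_of_le_condError ha₀ hα hv hn hU _ zero_le_one
      (fun y => tvDist_nonneg _ _) hint fun y => ?_⟩
  · have := hP y
    have := hQ y
    exact sqHellinger_le (hε y) (hle y)
  · rw [one_mul]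
    have := hP y
    have := hQ y
    exact tvDist_le (hε y) (hle y)

lemma condError_le {d : ℝ} (ha₀ : 0 < a₀) (hb₀ : 0 < b₀) (hα : 0 < α) (hd : 0 < d) (hv : d < v)
    (hn : 0 < n) (s : ℕ) {C : ℝ} (hC : 0 ≤ C) :
    condError a₀ b₀ α v n s (v * √n * C + v * s) ≤
      (2 * (s / √n) + 2 * (√n)⁻¹) * ((a₀ + b₀ / d) * (√n)⁻¹ + α / 2 * (C + s / √n)) / (α / 2) +
        2 * (s / √n) / √(α / 2) := by
  have hv0 : 0 < v := hd.trans hv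
  have hq : 0 < √(n : ℝ) := by positivity
  have hnsq : √(n : ℝ) ^ 2 = n := sq_sqrt (by positivity)
  have h1 : (v * a₀ + b₀ + α / 2 * (v * √n * C + v * s)) / (v * (a₀ + α * n / 2)) ≤
      (a₀ + b₀ / d + α / 2 * (√n * C + s)) / (α / 2 * n) := by
    have : (v * a₀ + b₀ + α / 2 * (v * √n * C + v * s)) / (v * (a₀ + α * n / 2)) =
        (a₀ + b₀ / v + α / 2 * (√n * C + s)) / (a₀ + α * n / 2) := by
      field_simp
    rw [this]
    gcongr
    linarith
  have h2 : √(α / 2) * √n ≤ √(a₀ + α * n / 2) := by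
    rw [← sqrt_mul (by positivity)]
    exact sqrt_le_sqrt (by linarith)
  unfold condError
  calc _ ≤ (2 * s + 2) * ((a₀ + b₀ / d + α / 2 * (√n * C + s)) / (α / 2 * n)) +
        2 * s / (√(α / 2) * √n) := by gcongr
    _ = _ := by
        have hα' : 0 < √(α / 2) := by positivity
        generalize √(α / 2) = w at hα'
        generalize √(n : ℝ) = q at hq hnsq
        rw [← hnsq]
        field_simp

end Limit

/-- Bernstein–von Mises theorem (Theorem 6): if `s* = o(√n/log n)` and
`E_{β*}[π^n(S*)] → 1`, then the expected squared Hellinger distance (and hence the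
expected total variation distance) between the empirical Bayes posterior `Π^n` and
`N_{s*}(β̂_{S*}, (σ₀²/(α+γ))(X_{S*}ᵀX_{S*})⁻¹) ⊗ δ_{0,S*^c}` tends to `0`. -/
theorem bernstein_von_mises
    (p R sstar : ℕ → ℕ) (X : ∀ n, Matrix (Fin n) (Fin (p n)) ℝ)
    (βstar : ∀ n, Fin (p n) → ℝ) (σ0sq : ℕ → ℝ) (a₀ b₀ a c γ α d₁ d₂ : ℝ)
    (ha₀ : 0 < a₀) (hb₀ : 0 < b₀) (ha : 0 < a) (hc : 0 < c) (hγ : 0 < γ)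
    (hα0 : 0 < α) (hα1 : α < 1)
    (hnp : ∀ n, n ≤ p n) (hptop : Tendsto (fun n => p n) atTop atTop)
    (hrank : ∀ n, (X n).rank = R n)
    (hinv : ∀ n (S : Finset (Fin (p n))), S.card ≤ R n → IsUnit (gram (X n) S).det)
    (hsstar : ∀ n, sstar n = (Function.support (βstar n)).ncard)
    (hsR : ∀ n, sstar n ≤ R n)
    (hd₁ : 0 < d₁) (hA1 : ∀ n, d₁ < σ0sq n ∧ σ0sq n < d₂)
    -- `s* = o(√n / log n)`
    (hsO : (fun n => (sstar n : ℝ)) =o[atTop] fun n => Real.sqrt n / Real.log n)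
    -- `E_{β*}[π^n(S*)] → 1`
    (hpostS : Tendsto (fun n =>
        ∫ y, postModel (R n) (X n) a₀ b₀ a c γ α y (suppFinset (βstar n))
          ∂(dataDist (X n) (βstar n) (σ0sq n))) atTop (nhds 1)) :
    Tendsto (fun n =>
      ∫ y, sqHellinger (post (R n) (X n) a₀ b₀ a c γ α y)
          (gaussLimit (X n) (suppFinset (βstar n)) y (σ0sq n) (α + γ))
        ∂(dataDist (X n) (βstar n) (σ0sq n))) atTop (nhds 0) ∧
    Tendsto (fun n =>
      ∫ y, tvDist (post (R n) (X n) a₀ b₀ a c γ α y)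
          (gaussLimit (X n) (suppFinset (βstar n)) y (σ0sq n) (α + γ))
        ∂(dataDist (X n) (βstar n) (σ0sq n))) atTop (nhds 0) := by
  have hcard : ∀ n, (suppFinset (βstar n)).card = sstar n := fun n => by
    rw [hsstar, ← Set.ncard_coe_finset]
    congr 1
    ext j
    simp [suppFinset]
  have hw : Tendsto (fun n : ℕ => (√(n : ℝ))⁻¹) atTop (nhds 0) :=
    tendsto_inv_atTop_zero.comp (tendsto_sqrt_atTop.comp tendsto_natCast_atTop_atTop)
  have hu : Tendsto (fun n : ℕ => (sstar n : ℝ) / √n) atTop (nhds 0) := by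
    refine (hsO.trans_isBigO (Asymptotics.IsBigO.of_bound 1 ?_)).tendsto_div_nhds_zero
    filter_upwards [(tendsto_log_atTop.comp tendsto_natCast_atTop_atTop).eventually_ge_atTop 1]
      with n hn
    have hn' : 1 ≤ log n := hn
    rw [one_mul, norm_div, Real.norm_of_nonneg (sqrt_nonneg _),
      Real.norm_of_nonneg (zero_le_one.trans hn')]
    exact div_le_self (sqrt_nonneg _) hn'
  have hC : 0 ≤ (chiSqVar + 1) / 2 := by
    have : 0 ≤ chiSqVar := variance_nonneg _ _
    positivity
  set C := (chiSqVar + 1) / 2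
  let D : ℕ → ℝ := fun n =>
    1 - ∫ y, postModel (R n) (X n) a₀ b₀ a c γ α y (suppFinset (βstar n))
      ∂(dataDist (X n) (βstar n) (σ0sq n)) +
    ((2 * (sstar n / √n) + 2 * (√n)⁻¹) *
      ((a₀ + b₀ / d₁) * (√n)⁻¹ + α / 2 * (C + sstar n / √n)) / (α / 2) +
      2 * (sstar n / √n) / √(α / 2))
  have hlim : Tendsto D atTop (nhds 0) := by
    have h := (hpostS.const_sub 1).add ((((((hu.const_mul 2).add (hw.const_mul 2)).mul
      ((hw.const_mul (a₀ + b₀ / d₁)).add ((hu.const_add C).const_mul (α / 2)))).div_const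
        (α / 2))).add ((hu.const_mul 2).div_const √(α / 2)))
    simpa [D] using h
  have hbound : ∀ᶠ n in atTop,
      ∫ y, sqHellinger (post (R n) (X n) a₀ b₀ a c γ α y)
        (gaussLimit (X n) (suppFinset (βstar n)) y (σ0sq n) (α + γ))
          ∂(dataDist (X n) (βstar n) (σ0sq n)) ≤ 2 * D n ∧
      ∫ y, tvDist (post (R n) (X n) a₀ b₀ a c γ α y)
        (gaussLimit (X n) (suppFinset (βstar n)) y (σ0sq n) (α + γ))
          ∂(dataDist (X n) (βstar n) (σ0sq n)) ≤ 1 * D n := by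
    filter_upwards [hpostS.eventually_ne one_ne_zero, eventually_gt_atTop 0] with n hn hn0
    have h := integral_distances_le (R := R n) (X := X n) (β := βstar n) (a := a) ha₀ hb₀ hc hγ hα0
      (hd₁.trans (hA1 n).1) hn0 (hn0.trans_le (hnp n)) (hinv n) ((hcard n).trans_le (hsR n))
      (not_imp_comm.1 integral_undef hn)
    rw [hcard] at h
    have hle := condError_le ha₀ hb₀ hα0 hd₁ (hA1 n).1 hn0 (sstar n) hC
    exact ⟨h.1.trans (mul_le_mul_of_nonneg_left (add_le_add_right hle _) zero_le_two),
      h.2.trans (mul_le_mul_of_nonneg_left (add_le_add_right hle _) zero_le_one)⟩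
  refine ⟨squeeze_zero' (Eventually.of_forall fun n => integral_nonneg fun y =>
      sqHellinger_nonneg _ _) (hbound.mono fun n h => h.1) ?_,
    squeeze_zero' (Eventually.of_forall fun n => integral_nonneg fun y =>
      tvDist_nonneg _ _) (hbound.mono fun n h => h.2) ?_⟩
  · simpa using hlim.const_mul 2
  · simpa using hlim

end EmpiricalBayes
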